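/- arXiv:1304.7482 — 5 statements merged into one kernel-verified Lean document; each statement's English description precedes it below -/
import Mathlib

section
/- Let O be a nonempty connected open subset of ℝ^N, let J : O → End(ℝ^m) be a continuous map, and suppose there is a function s : O × O → ℝ such that for all x, y ∈ O one has Spec{J(x)} = s(x,y)·Spec{J(y)} ≠ {0}. Then: (i) for all x, y ∈ O one also has Spec{J(x)} = |s(x,y)|·Spec{J(y)} ≠ {0}; (ii) there exists an integer k with 1 ≤ k ≤ m such that Tr(J(y)^k) ≠ 0 for every y ∈ O, the ratio Tr(J(x)^k)/Tr(J(y)^k) is positive, and |s(x,y)| = (Tr(J(x)^k)/Tr(J(y)^k))^{1/k} for all x, y ∈ O; (iii) consequently the function (x,y) ↦ |s(x,y)| is continuous on O × O. -/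
open Polynomial

/-- The spectrum of a real square matrix: the set of complex roots of its
characteristic polynomial. -/
noncomputable def spec {m : ℕ} (M : Matrix (Fin m) (Fin m) ℝ) : Set ℂ :=
  (Matrix.charpoly M).rootSet ℂ

namespace Matrix

variable {n K : Type*} [Fintype n] [DecidableEq n] [Field K] [IsAlgClosed K]

theorem charpoly_eq_prod_roots (A : Matrix n n K) :
    A.charpoly = (A.charpoly.roots.map fun z => X - C z).prod :=
  (IsAlgClosed.splits A.charpoly).eq_prod_roots_of_monic A.charpoly_monic

theorem card_roots_charpoly (A : Matrix n n K) : A.charpoly.roots.card = Fintype.card n := by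
  rw [← (IsAlgClosed.splits A.charpoly).natDegree_eq_card_roots, A.charpoly_natDegree_eq_dim]

/-- The determinant of `q(A)` is the product of the values of `q` at the eigenvalues of `A`. -/
theorem det_aeval_eq_prod_roots_charpoly (A : Matrix n n K) (q : K[X]) :
    (aeval A q).det = (A.charpoly.roots.map fun z => q.eval z).prod := by
  have key : ∀ t : Multiset K,
      (aeval A (t.map fun a => X - C a).prod).det =
        (A.charpoly.roots.map fun z => (t.map fun a => X - C a).prod.eval z).prod := by
    intro t
    induction t using Multiset.induction_on with
    | empty => simp
    | cons a t ih =>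
      have hroots : (A.charpoly.roots.map fun z => z - a).prod = (A - scalar n a).det := by
        have h1 : A.charpoly.eval a = (A.charpoly.roots.map fun z => a - z).prod := by
          conv_lhs => rw [charpoly_eq_prod_roots]
          rw [eval_multiset_prod, Multiset.map_map]
          simp
        have h2 : A - scalar n a = -(scalar n a - A) := by abel
        rw [h2, det_neg, ← eval_charpoly, h1, ← card_roots_charpoly A,
          ← Multiset.card_map (fun z => a - z), ← Multiset.prod_map_neg, Multiset.map_map]
        simp
      have hlin : aeval A (X - C a) = A - scalar n a := by
        simp [aeval_C, algebraMap_eq_diagonal, Pi.algebraMap_def]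
      rw [Multiset.map_cons, Multiset.prod_cons, map_mul, det_mul, ih, hlin, ← hroots,
        ← Multiset.prod_map_mul]
      simp
  rw [(IsAlgClosed.splits q).eq_prod_roots, map_mul, aeval_C, det_mul, key,
    algebraMap_eq_diagonal, det_diagonal]
  simp [Multiset.prod_map_mul, card_roots_charpoly]

/-- Spectral mapping with multiplicities: the eigenvalues of `q(A)` are the values of `q` at
those of `A`. -/
theorem roots_charpoly_aeval (A : Matrix n n K) (q : K[X]) :
    (aeval A q).charpoly.roots = A.charpoly.roots.map fun z => q.eval z := by
  have : (aeval A q).charpoly = ((A.charpoly.roots.map fun z => q.eval z).map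
      fun z => X - C z).prod := by
    refine Polynomial.funext fun t => ?_
    have h : scalar n t - aeval A q = aeval A (C t - q) := by
      simp [aeval_C, algebraMap_eq_diagonal, Pi.algebraMap_def]
    rw [eval_charpoly, h, det_aeval_eq_prod_roots_charpoly, eval_multiset_prod, Multiset.map_map,
      Multiset.map_map]
    simp
  rw [this, roots_multiset_prod_X_sub_C]

theorem roots_charpoly_smul (A : Matrix n n K) (c : K) :
    (c • A).charpoly.roots = A.charpoly.roots.map fun z => c * z := by
  have h : c • A = aeval A (C c * X) := by simp [Algebra.smul_def]
  rw [h, roots_charpoly_aeval]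
  simp

theorem trace_pow_eq_sum_roots_charpoly (A : Matrix n n K) (k : ℕ) :
    (A ^ k).trace = (A.charpoly.roots.map fun z => z ^ k).sum := by
  have h : A ^ k = aeval A (X ^ k : K[X]) := by simp
  rw [trace_eq_sum_roots_charpoly, h, roots_charpoly_aeval]
  simp

end Matrix

/-- A multiset in a domain of characteristic zero whose first power sums vanish is zero. -/
theorem Multiset.eq_zero_of_forall_sum_pow_eq_zero {K : Type*} [CommRing K] [IsDomain K]
    [CharZero K] {t : Multiset K} {m : ℕ} (hm : t.card ≤ m)
    (h : ∀ k, 1 ≤ k → k ≤ m → (t.map fun z => z ^ k).sum = 0) : ∀ z ∈ t, z = 0 := by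
  classical
  intro z hz
  by_contra hz0
  set S := t.toFinset.erase 0 with hS
  let e := S.equivFin.symm
  have hcard : S.card ≤ m :=
    ((Finset.card_erase_le).trans (Multiset.toFinset_card_le t)).trans hm
  have hv := Matrix.eq_zero_of_forall_pow_sum_mul_pow_eq_zero
    (f := fun j => (e j : K)) (v := fun j => (t.count (e j : K) : K) * (e j : K))
    (Subtype.val_injective.comp e.injective) (by
      intro i
      rw [← h (i + 1) (by omega) (by omega), Finset.sum_multiset_map_count,
        e.sum_comp (fun x : S => (t.count (x : K) : K) * (x : K) * (x : K) ^ (i : ℕ)),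
        Finset.sum_coe_sort S (fun x => (t.count x : K) * x * x ^ (i : ℕ)),
        ← Finset.sum_subset (hS.trans_subset (Finset.erase_subset 0 t.toFinset))]
      · refine Finset.sum_congr rfl fun x _ => ?_
        rw [nsmul_eq_mul]; ring
      · intro x hx hx'
        have : x = 0 := by
          by_contra h0
          exact hx' (Finset.mem_erase.2 ⟨h0, hx⟩)
        simp [this])
  have hzS : z ∈ S := Finset.mem_erase.2 ⟨hz0, Multiset.mem_toFinset.2 hz⟩
  have := congrFun hv (e.symm ⟨z, hzS⟩)
  simp [hz0, hz] at this

/-- A gauge on multisets of complex numbers built from power sums, homogeneous of degree one. -/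
noncomputable def powerSumGauge (m : ℕ) (t : Multiset ℂ) : ℝ :=
  ∑ k ∈ Finset.Icc 1 m, ‖(t.map fun z => z ^ k).sum‖ ^ ((1 : ℝ) / k)

theorem sum_map_mul_pow (c : ℂ) (t : Multiset ℂ) (k : ℕ) :
    ((t.map fun z => c * z).map fun z => z ^ k).sum = c ^ k * (t.map fun z => z ^ k).sum := by
  rw [Multiset.map_map, ← Multiset.sum_map_mul_left]
  simp [mul_pow]

theorem powerSumGauge_map_mul (m : ℕ) {c : ℝ} (hc : 0 ≤ c) (t : Multiset ℂ) :
    powerSumGauge m (t.map fun z => (c : ℂ) * z) = c * powerSumGauge m t := by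
  rw [powerSumGauge, powerSumGauge, Finset.mul_sum]
  refine Finset.sum_congr rfl fun k hk => ?_
  have hk0 : k ≠ 0 := by have := (Finset.mem_Icc.1 hk).1; omega
  rw [sum_map_mul_pow, norm_mul, norm_pow, Complex.norm_real, Real.norm_of_nonneg hc,
    Real.mul_rpow (by positivity) (norm_nonneg _), one_div, Real.pow_rpow_inv_natCast hc hk0]

theorem powerSumGauge_pos {m : ℕ} {t : Multiset ℂ} (hm : t.card ≤ m) (ht : ∃ z ∈ t, z ≠ 0) :
    0 < powerSumGauge m t := by
  obtain ⟨z, hz, hz0⟩ := ht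
  have : ∃ k, 1 ≤ k ∧ k ≤ m ∧ (t.map fun z => z ^ k).sum ≠ 0 := by
    by_contra! h
    exact hz0 (Multiset.eq_zero_of_forall_sum_pow_eq_zero hm h z hz)
  obtain ⟨k, h1, h2, h3⟩ := this
  refine Finset.sum_pos' (fun _ _ => by positivity) ⟨k, Finset.mem_Icc.2 ⟨h1, h2⟩, ?_⟩
  have := norm_pos_iff.2 h3
  positivity

theorem finite_setOf_multiset_card_le {α : Type*} {F : Set α} (hF : F.Finite) (m : ℕ) :
    {t : Multiset α | t.card ≤ m ∧ ∀ z ∈ t, z ∈ F}.Finite := by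
  classical
  refine (Set.finite_Iic (m • hF.toFinset.val)).subset fun t ht => ?_
  rw [Set.mem_Iic, Multiset.le_iff_count]
  intro a
  by_cases ha : a ∈ t
  · rw [Multiset.count_nsmul, Multiset.count_eq_one_of_mem hF.toFinset.nodup
      (by simpa using ht.2 a ha), mul_one]
    exact (Multiset.count_le_card a t).trans ht.1
  · simp [Multiset.count_eq_zero_of_notMem ha]

theorem continuousOn_powerSumGauge_roots_charpoly {X : Type*} [TopologicalSpace X] {O : Set X}
    {n : Type*} [Fintype n] [DecidableEq n] {A : X → Matrix n n ℂ} (hA : ContinuousOn A O)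
    (m : ℕ) : ContinuousOn (fun x => powerSumGauge m (A x).charpoly.roots) O := by
  simp only [powerSumGauge, ← Matrix.trace_pow_eq_sum_roots_charpoly]
  refine continuousOn_finsetSum _ fun k _ => ?_
  refine ContinuousOn.rpow_const ?_ fun _ _ => Or.inr (by positivity)
  exact ((continuous_id.matrix_trace).comp_continuousOn (hA.pow k)).norm

/-- If, up to positive scalars, the eigenvalues of a continuous family of non-nilpotent matrices
over a preconnected set lie in a fixed finite set, then all of these matrices have the same
eigenvalues with multiplicities up to positive scalars. -/
theorem roots_charpoly_eq_map_of_isPreconnected {X : Type*} [TopologicalSpace X] {O : Set X}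
    (hO : IsPreconnected O) {n : Type*} [Fintype n] [DecidableEq n] {A : X → Matrix n n ℂ}
    (hA : ContinuousOn A O) {F : Set ℂ} (hF : F.Finite)
    (hAF : ∀ x ∈ O, ∃ c : ℝ, 0 < c ∧ ∀ z ∈ (A x).charpoly.roots, (c : ℂ) * z ∈ F)
    {m : ℕ} (hpos : ∀ x ∈ O, 0 < powerSumGauge m (A x).charpoly.roots)
    {x y : X} (hx : x ∈ O) (hy : y ∈ O) :
    (A x).charpoly.roots = (A y).charpoly.roots.map fun z =>
      ((powerSumGauge m (A x).charpoly.roots / powerSumGauge m (A y).charpoly.roots : ℝ) : ℂ)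
        * z := by
  set g : X → ℝ := fun x => powerSumGauge m (A x).charpoly.roots with hg
  have hgc : ContinuousOn g O := continuousOn_powerSumGauge_roots_charpoly hA m
  let B : X → Matrix n n ℂ := fun x => (((g x)⁻¹ : ℝ) : ℂ) • A x
  have hB : ContinuousOn B O :=
    (Complex.continuous_ofReal.comp_continuousOn
      (hgc.inv₀ fun x hx => (hpos x hx).ne')).smul hA
  let Ψ : Multiset ℂ → Multiset ℂ := fun t => t.map fun z => (((powerSumGauge m t)⁻¹ : ℝ) : ℂ) * z
  have hBmem : ∀ x ∈ O, (B x).charpoly.roots ∈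
      Ψ '' {t : Multiset ℂ | t.card ≤ Fintype.card n ∧ ∀ z ∈ t, z ∈ F} := by
    intro x hx
    obtain ⟨c, hc, hcF⟩ := hAF x hx
    refine ⟨(A x).charpoly.roots.map fun z => (c : ℂ) * z, ⟨?_, ?_⟩, ?_⟩
    · rw [Multiset.card_map, Matrix.card_roots_charpoly]
    · intro z hz
      obtain ⟨w, hw, rfl⟩ := Multiset.mem_map.1 hz
      exact hcF w hw
    · simp only [Ψ, B]
      rw [powerSumGauge_map_mul m hc.le, Matrix.roots_charpoly_smul, Multiset.map_map]
      refine Multiset.map_congr rfl fun z _ => ?_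
      have := (Complex.ofReal_ne_zero.2 hc.ne')
      simp only [Function.comp_apply, Complex.ofReal_inv, Complex.ofReal_mul, hg]
      field_simp
  have hBeq : (B x).charpoly = (B y).charpoly := by
    refine Polynomial.funext fun a => ?_
    have hfin := (((finite_setOf_multiset_card_le hF (Fintype.card n)).image Ψ).image
      fun t => (t.map fun z => (Polynomial.X - C z : ℂ[X])).prod.eval a)
    refine hO.constant_of_mapsTo (f := fun x => (B x).charpoly.eval a) hfin.isDiscrete ?_ ?_ hx hy
    · simp only [Matrix.eval_charpoly]
      exact (continuous_id.matrix_det).comp_continuousOn (continuousOn_const.sub hB)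
    · intro x hx
      refine ⟨_, hBmem x hx, ?_⟩
      simp only [← Matrix.charpoly_eq_prod_roots]
  have hroots := congrArg Polynomial.roots hBeq
  simp only [B, Matrix.roots_charpoly_smul] at hroots
  have hx0 : ((g x : ℝ) : ℂ) ≠ 0 := Complex.ofReal_ne_zero.2 (hpos x hx).ne'
  have h := congrArg (Multiset.map fun z => (g x : ℂ) * z) hroots
  rw [Multiset.map_map, Multiset.map_map] at h
  calc (A x).charpoly.roots = (A x).charpoly.roots.map
        ((fun z => (g x : ℂ) * z) ∘ fun z => (((g x)⁻¹ : ℝ) : ℂ) * z) := by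
          conv_lhs => rw [← Multiset.map_id (A x).charpoly.roots]
          refine Multiset.map_congr rfl fun z _ => ?_
          simp [hx0]
    _ = _ := by
          rw [h]
          refine Multiset.map_congr rfl fun z _ => ?_
          simp [hg, div_eq_mul_inv, mul_assoc]

/-- Two real scalings of a finite set of complex numbers, not contained in `{0}`, that agree
as sets have the same absolute value. -/
theorem abs_eq_abs_of_image_mul_eq {S : Set ℂ} (hS : S.Finite) (hS0 : ∃ z ∈ S, z ≠ 0) {a b : ℝ}
    (h : (fun z : ℂ => (a : ℂ) * z) '' S = (fun z : ℂ => (b : ℂ) * z) '' S) : |a| = |b| := by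
  obtain ⟨w, hw, hw0⟩ := hS0
  obtain ⟨z, hz, hmax⟩ := hS.exists_maximalFor (fun z => ‖z‖) S ⟨w, hw⟩
  have hmax' : ∀ u ∈ S, ‖u‖ ≤ ‖z‖ := fun u hu => by
    rcases le_total ‖u‖ ‖z‖ with h | h
    · exact h
    · exact hmax hu h
  have hz0 : 0 < ‖z‖ := (norm_pos_iff.2 hw0).trans_le (hmax' w hw)
  have key : ∀ {a b : ℝ}, (fun z : ℂ => (a : ℂ) * z) '' S = (fun z : ℂ => (b : ℂ) * z) '' S →
      |a| ≤ |b| := by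
    intro a b h
    obtain ⟨u, hu, hu'⟩ := h.subset ⟨z, hz, rfl⟩
    have h1 : |b| * ‖u‖ = |a| * ‖z‖ := by simpa using congrArg norm hu'
    have h2 := mul_le_mul_of_nonneg_left (hmax' u hu) (abs_nonneg b)
    exact le_of_mul_le_mul_right (h1 ▸ h2) hz0
  exact le_antisymm (key h) (key h.symm)

theorem mem_spec_iff {m : ℕ} (M : Matrix (Fin m) (Fin m) ℝ) (z : ℂ) :
    z ∈ spec M ↔ z ∈ (M.map (algebraMap ℝ ℂ)).charpoly.roots := by
  rw [spec, Matrix.charpoly_map, mem_rootSet', mem_roots', IsRoot.def, eval_map_algebraMap]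

theorem ofReal_trace_pow {m : ℕ} (M : Matrix (Fin m) (Fin m) ℝ) (k : ℕ) :
    (((M ^ k).trace : ℝ) : ℂ) =
      ((M.map (algebraMap ℝ ℂ)).charpoly.roots.map fun z => z ^ k).sum := by
  rw [← Matrix.trace_pow_eq_sum_roots_charpoly, ← Matrix.map_pow]
  exact AddMonoidHom.map_trace (algebraMap ℝ ℂ) (M ^ k)

theorem exists_ne_zero_mem_spec {m : ℕ} (hm : 1 ≤ m) {M : Matrix (Fin m) (Fin m) ℝ}
    (h : spec M ≠ {0}) : ∃ z ∈ spec M, z ≠ 0 := by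
  by_contra! h0
  refine h (Set.Subset.antisymm h0 ?_)
  obtain ⟨z, hz⟩ : ∃ z, z ∈ (M.map (algebraMap ℝ ℂ)).charpoly.roots := by
    rw [← Multiset.card_pos_iff_exists_mem, Matrix.card_roots_charpoly, Fintype.card_fin]
    exact hm
  rw [← mem_spec_iff] at hz
  rw [Set.singleton_subset_iff, ← h0 z hz]
  exact hz

/-- Lemma 1.5 (2)-(4): if `J` is a continuous family of endomorphisms on a nonempty
connected open set `O` whose projectivized spectra agree with scaling factor `s`, then
(i) the spectra also agree with scaling factor `|s|`;
(ii) there is a `k` with `1 ≤ k ≤ m` so that the traces of the `k`-th powers never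
vanish, the ratios of these traces are positive, and `|s(x,y)|` is the `k`-th root
of the ratio of traces; (iii) `(x,y) ↦ |s(x,y)|` is continuous. -/
theorem stmt_1 {N m : ℕ} (hm : 1 ≤ m)
    (O : Set (Fin N → ℝ)) (hOconn : IsConnected O) (hOopen : IsOpen O)
    (J : (Fin N → ℝ) → Matrix (Fin m) (Fin m) ℝ) (hJ : ContinuousOn J O)
    (s : (Fin N → ℝ) → (Fin N → ℝ) → ℝ)
    (hs : ∀ x ∈ O, ∀ y ∈ O,
      spec (J x) = (fun μ : ℂ => (s x y : ℂ) * μ) '' spec (J y) ∧ spec (J x) ≠ {0}) :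
    (∀ x ∈ O, ∀ y ∈ O,
      spec (J x) = (fun μ : ℂ => ((|s x y| : ℝ) : ℂ) * μ) '' spec (J y) ∧ spec (J x) ≠ {0}) ∧
    (∃ k : ℕ, 1 ≤ k ∧ k ≤ m ∧
      (∀ y ∈ O, Matrix.trace ((J y) ^ k) ≠ 0) ∧
      (∀ x ∈ O, ∀ y ∈ O,
        0 < Matrix.trace ((J x) ^ k) / Matrix.trace ((J y) ^ k) ∧
        |s x y| =
          (Matrix.trace ((J x) ^ k) / Matrix.trace ((J y) ^ k)) ^ ((1 : ℝ) / k))) ∧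
    ContinuousOn (fun p : (Fin N → ℝ) × (Fin N → ℝ) => |s p.1 p.2|) (O ×ˢ O) := by
  set A : (Fin N → ℝ) → Matrix (Fin m) (Fin m) ℂ := fun x => (J x).map (algebraMap ℝ ℂ) with hAdef
  have hA : ContinuousOn A O :=
    (continuous_id.matrix_map Complex.continuous_ofReal).comp_continuousOn hJ
  set g : (Fin N → ℝ) → ℝ := fun x => powerSumGauge m (A x).charpoly.roots with hg
  have hne : ∀ x ∈ O, ∃ z ∈ spec (J x), z ≠ 0 := fun x hx =>
    exists_ne_zero_mem_spec hm (hs x hx x hx).2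
  have hfin : ∀ x, (spec (J x)).Finite := fun x => rootSet_finite _ _
  have hcard : ∀ x, (A x).charpoly.roots.card ≤ m := fun x => by
    rw [Matrix.card_roots_charpoly, Fintype.card_fin]
  have hroots_ne : ∀ x ∈ O, ∃ z ∈ (A x).charpoly.roots, z ≠ 0 := fun x hx => by
    simpa only [mem_spec_iff] using hne x hx
  have hpos : ∀ x ∈ O, 0 < g x := fun x hx => powerSumGauge_pos (hcard x) (hroots_ne x hx)
  obtain ⟨o, ho⟩ := hOconn.nonempty
  have hs0 : ∀ x ∈ O, s x o ≠ 0 := by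
    intro x hx h0
    obtain ⟨z, hz, hz0⟩ := hne x hx
    rw [(hs x hx o ho).1] at hz
    obtain ⟨w, -, rfl⟩ := hz
    simp [h0] at hz0
  have hmap : ∀ x ∈ O, ∀ y ∈ O, (A x).charpoly.roots =
      (A y).charpoly.roots.map fun z => ((g x / g y : ℝ) : ℂ) * z := by
    intro x hx y hy
    refine roots_charpoly_eq_map_of_isPreconnected hOconn.isPreconnected hA
      (F := spec (J o) ∪ (fun z => -z) '' spec (J o)) ((hfin o).union ((hfin o).image _))
      (fun x hx => ⟨|s x o|⁻¹, by have := hs0 x hx; positivity, fun z hz => ?_⟩) hpos hx hy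
    rw [← mem_spec_iff, (hs x hx o ho).1] at hz
    obtain ⟨w, hw, rfl⟩ := hz
    have h0 : (s x o : ℂ) ≠ 0 := Complex.ofReal_ne_zero.2 (hs0 x hx)
    rcases abs_choice (s x o) with h | h
    · left; simpa [h, h0] using hw
    · right; exact ⟨w, hw, by simp [h, h0, inv_neg]⟩
  have hspec : ∀ x ∈ O, ∀ y ∈ O,
      spec (J x) = (fun z : ℂ => ((g x / g y : ℝ) : ℂ) * z) '' spec (J y) := by
    intro x hx y hy
    ext z
    have h := congrArg (z ∈ ·) (hmap x hx y hy)
    simp only [Multiset.mem_map, hAdef, ← mem_spec_iff, eq_iff_iff] at h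
    exact h
  have habs : ∀ x ∈ O, ∀ y ∈ O, |s x y| = g x / g y := by
    intro x hx y hy
    rw [← abs_of_pos (div_pos (hpos x hx) (hpos y hy))]
    exact abs_eq_abs_of_image_mul_eq (hfin y) (hne y hy)
      ((hs x hx y hy).1.symm.trans (hspec x hx y hy))
  have htrace : ∀ k, ∀ x ∈ O, ∀ y ∈ O,
      Matrix.trace (J x ^ k) = (g x / g y) ^ k * Matrix.trace (J y ^ k) := by
    intro k x hx y hy
    have h : ((Matrix.trace (J x ^ k) : ℝ) : ℂ) =
        ((g x / g y : ℝ) : ℂ) ^ k * ((Matrix.trace (J y ^ k) : ℝ) : ℂ) := by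
      rw [ofReal_trace_pow, ofReal_trace_pow, ← sum_map_mul_pow]
      exact congrArg (fun t : Multiset ℂ => (t.map fun z => z ^ k).sum) (hmap x hx y hy)
    exact_mod_cast h
  refine ⟨fun x hx y hy => ⟨?_, (hs x hx y hy).2⟩, ?_, ?_⟩
  · rw [habs x hx y hy]
    exact hspec x hx y hy
  · obtain ⟨k, hk1, hkm, hk⟩ : ∃ k, 1 ≤ k ∧ k ≤ m ∧ Matrix.trace (J o ^ k) ≠ 0 := by
      by_contra! h
      obtain ⟨z, hz, hz0⟩ := hroots_ne o ho
      refine hz0 (Multiset.eq_zero_of_forall_sum_pow_eq_zero (hcard o) (fun k h1 h2 => ?_) z hz)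
      rw [← ofReal_trace_pow, h k h1 h2, Complex.ofReal_zero]
    have hky : ∀ y ∈ O, Matrix.trace (J y ^ k) ≠ 0 := fun y hy => by
      rw [htrace k y hy o ho]
      exact mul_ne_zero (pow_pos (div_pos (hpos y hy) (hpos o ho)) k).ne' hk
    refine ⟨k, hk1, hkm, hky, fun x hx y hy => ?_⟩
    have hr := div_pos (hpos x hx) (hpos y hy)
    rw [htrace k x hx y hy, mul_div_cancel_right₀ _ (hky y hy), habs x hx y hy, one_div,
      Real.pow_rpow_inv_natCast hr.le (by omega)]
    exact ⟨pow_pos hr k, rfl⟩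
  · have hgc : ContinuousOn g O := continuousOn_powerSumGauge_roots_charpoly hA m
    refine ContinuousOn.congr ?_ fun p hp => habs p.1 hp.1 p.2 hp.2
    exact (hgc.comp continuousOn_fst fun p hp => hp.1).div
      (hgc.comp continuousOn_snd fun p hp => hp.2) fun p hp => (hpos p.2 hp.2).ne'
end

section
/- Fix ε ∈ ℝ and m ≥ 3. Define functions Γ_{ij}{}^k : ℝ^m → ℝ by Γ_{mm}{}^m = 2; Γ_{im}{}^i = Γ_{mi}{}^i = Γ_{ii}{}^m = 1 for 1 ≤ i ≤ m−1; Γ_{11}{}^1(x) = ε(x₁ + x₂); Γ_{22}{}^2(x) = −ε(x₁ + x₂); and all other components zero. Define the curvature tensor R_{ijk}{}^l := ∂_{x_i}Γ_{jk}{}^l − ∂_{x_j}Γ_{ik}{}^l + Σ_n (Γ_{in}{}^l Γ_{jk}{}^n − Γ_{jn}{}^l Γ_{ik}{}^n). Then at every point x ∈ ℝ^m and for all indices, Σ_l R_{ijk}{}^l(x) e_l = A_ε(e_i, e_j) e_k, where A_ε(x,y)z := ⟨y,z⟩x − ⟨x,z⟩y − ε(x₁y₂ − x₂y₁)(z₁e₁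 + z₂e₂). Hence the torsion-free connection with these Christoffel symbols realizes the affine projective Osserman model 𝔐_ε at every point. -/
open Polynomial

/-- The curvature tensor of Theorem 1.11:
`A_ε(x,y)z = ⟨y,z⟩x − ⟨x,z⟩y − ε(x₁y₂ − x₂y₁)(z₁e₁ + z₂e₂)`. -/
noncomputable def Aeps (m : ℕ) (hm : 2 ≤ m) (ε : ℝ) (x y z : Fin m → ℝ) :
    Fin m → ℝ :=
  (∑ i, y i * z i) • x - (∑ i, x i * z i) • y -
    (ε * (x ⟨0, by omega⟩ * y ⟨1, by omega⟩ - x ⟨1, by omega⟩ * y ⟨0, by omega⟩)) •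
      (z ⟨0, by omega⟩ • (Pi.single (⟨0, by omega⟩ : Fin m) (1 : ℝ) : Fin m → ℝ) +
       z ⟨1, by omega⟩ • (Pi.single (⟨1, by omega⟩ : Fin m) (1 : ℝ) : Fin m → ℝ))


/-- The Christoffel symbols of Theorem 1.11(2): `Γ_mm^m = 2`,
`Γ_im^i = Γ_mi^i = Γ_ii^m = 1` for `i < m`, `Γ_11^1(x) = ε(x₁+x₂)`,
`Γ_22^2(x) = −ε(x₁+x₂)`, all other components zero (indices are 0-based, so the
paper's index `m` is `m−1` here, `1` is `0`, and `2` is `1`). -/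
def Gam (m : ℕ) (hm : 3 ≤ m) (ε : ℝ) (i j k : Fin m) (x : Fin m → ℝ) : ℝ :=
  (if i = j ∧ j = k ∧ (k : ℕ) = m - 1 then 2 else 0)
  + (if (i : ℕ) < m - 1 ∧ (j : ℕ) = m - 1 ∧ k = i then 1 else 0)
  + (if (j : ℕ) < m - 1 ∧ (i : ℕ) = m - 1 ∧ k = j then 1 else 0)
  + (if (i : ℕ) < m - 1 ∧ i = j ∧ (k : ℕ) = m - 1 then 1 else 0)
  + (if (i : ℕ) = 0 ∧ (j : ℕ) = 0 ∧ (k : ℕ) = 0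
      then ε * (x ⟨0, by omega⟩ + x ⟨1, by omega⟩) else 0)
  + (if (i : ℕ) = 1 ∧ (j : ℕ) = 1 ∧ (k : ℕ) = 1
      then -(ε * (x ⟨0, by omega⟩ + x ⟨1, by omega⟩)) else 0)

/-- The curvature tensor of the torsion-free connection with Christoffel symbols
`Γ`: `R_ijk^l = ∂_i Γ_jk^l − ∂_j Γ_ik^l + Σ_n (Γ_in^l Γ_jk^n − Γ_jn^l Γ_ik^n)`. -/
noncomputable def curvGam (m : ℕ) (hm : 3 ≤ m) (ε : ℝ) (i j k l : Fin m)
    (x : Fin m → ℝ) : ℝ :=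
  fderiv ℝ (Gam m hm ε j k l) x (Pi.single i 1)
  - fderiv ℝ (Gam m hm ε i k l) x (Pi.single j 1)
  + ∑ n, (Gam m hm ε i n l x * Gam m hm ε j k n x
          - Gam m hm ε j n l x * Gam m hm ε i k n x)

/-- A form of the Christoffel symbols as a polynomial in Kronecker deltas, where `p` is the last
index and `a`, `b` are the first two. -/
lemma Gam_eq_single {m : ℕ} (hm : 3 ≤ m) (ε : ℝ) {a b p : Fin m}
    (ha : (a : ℕ) = 0) (hb : (b : ℕ) = 1) (hp : (p : ℕ) = m - 1) (i j k : Fin m)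
    (x : Fin m → ℝ) :
    Gam m hm ε i j k x =
      (if j = p then 1 else 0) * (if i = k then 1 else 0)
      + (if i = p then 1 else 0) * (if j = k then 1 else 0)
      + (if k = p then 1 else 0) *
        ((if i = j then 1 else 0) - (if i = p then 1 else 0) * (if j = p then 1 else 0))
      + (ε * (x a + x b)) *
        (((if i = a then 1 else 0) * (if j = a then 1 else 0)) * (if k = a then 1 else 0)
          - ((if i = b then 1 else 0) * (if j = b then 1 else 0)) * (if k = b then 1 else 0)) := by
  have ha' : (⟨0, by omega⟩ : Fin m) = a := Fin.ext ha.symm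
  have hb' : (⟨1, by omega⟩ : Fin m) = b := Fin.ext hb.symm
  have h0 (t : Fin m) : (t : ℕ) = 0 ↔ t = a := by rw [Fin.ext_iff, ha]
  have h1 (t : Fin m) : (t : ℕ) = 1 ↔ t = b := by rw [Fin.ext_iff, hb]
  have hl (t : Fin m) : (t : ℕ) = m - 1 ↔ t = p := by rw [Fin.ext_iff, hp]
  have hlt (t : Fin m) : (t : ℕ) < m - 1 ↔ t ≠ p := by rw [Ne, Fin.ext_iff, hp]; omega
  simp only [Gam, ha', hb', h0, h1, hl, hlt]
  have hab : a ≠ b := by rw [Ne, Fin.ext_iff]; omega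
  clear ha hb hp ha' hb' h0 h1 hl hlt
  generalize ε * (x a + x b) = s
  grind (splits := 30)

/-- Contraction of the Christoffel symbols with a vector in the second lower slot. -/
lemma sum_Gam_mul {m : ℕ} (hm : 3 ≤ m) (ε : ℝ) {a b p : Fin m}
    (ha : (a : ℕ) = 0) (hb : (b : ℕ) = 1) (hp : (p : ℕ) = m - 1) (i l : Fin m)
    (x f : Fin m → ℝ) :
    ∑ n, Gam m hm ε i n l x * f n =
      (if i = l then 1 else 0) * f p + (if i = p then 1 else 0) * f l
      + (if l = p then 1 else 0) * (f i - (if i = p then 1 else 0) * f p)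
      + (ε * (x a + x b)) *
        (((if i = a then 1 else 0) * (if l = a then 1 else 0)) * f a - ((if i = b then 1 else 0) * (if l = b then 1 else 0)) * f b) := by
  have key (n : Fin m) : Gam m hm ε i n l x * f n =
      (if n = p then 1 else 0) * ((if i = l then 1 else 0) * f n)
      + (if n = l then 1 else 0) * ((if i = p then 1 else 0) * f n)
      + (if n = i then 1 else 0) * ((if l = p then 1 else 0) * f n)
      - (if n = p then 1 else 0) * ((if l = p then 1 else 0) * (if i = p then 1 else 0) * f n)
      + (if n = a then 1 else 0) *
        ((ε * (x a + x b)) * ((if i = a then 1 else 0) * (if l = a then 1 else 0)) * f n)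
      - (if n = b then 1 else 0) *
        ((ε * (x a + x b)) * ((if i = b then 1 else 0) * (if l = b then 1 else 0)) * f n) := by
    rw [Gam_eq_single hm ε ha hb hp]
    simp only [eq_comm (a := i) (b := n)]
    ring
  have pick (q : Fin m) (g : Fin m → ℝ) : ∑ n, (if n = q then 1 else 0) * g n = g q := by simp
  rw [Finset.sum_congr rfl fun n _ => key n]
  simp only [Finset.sum_add_distrib, Finset.sum_sub_distrib]
  simp only [pick]
  ring

lemma fderiv_Gam_single {m : ℕ} (hm : 3 ≤ m) (ε : ℝ) {a b p : Fin m}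
    (ha : (a : ℕ) = 0) (hb : (b : ℕ) = 1) (hp : (p : ℕ) = m - 1) (i j k t : Fin m)
    (x : Fin m → ℝ) :
    fderiv ℝ (Gam m hm ε i j k) x (Pi.single t 1) =
      (ε * ((if t = a then 1 else 0) + (if t = b then 1 else 0))) *
        (((if i = a then 1 else 0) * (if j = a then 1 else 0)) * (if k = a then 1 else 0)
          - ((if i = b then 1 else 0) * (if j = b then 1 else 0)) * (if k = b then 1 else 0)) := by
  have hG := funext (Gam_eq_single hm ε ha hb hp i j k)
  have hd := (((((hasFDerivAt_apply (𝕜 := ℝ) a x).add (hasFDerivAt_apply (𝕜 := ℝ) b x)).const_mul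
    ε).mul_const (((if i = a then 1 else 0) * (if j = a then 1 else 0)) * (if k = a then 1 else 0)
          - ((if i = b then 1 else 0) * (if j = b then 1 else 0)) * (if k = b then 1 else 0))).const_add
    ((if j = p then 1 else 0) * (if i = k then 1 else 0)
      + (if i = p then 1 else 0) * (if j = k then 1 else 0)
      + (if k = p then 1 else 0) *
        ((if i = j then 1 else 0) - (if i = p then 1 else 0) * (if j = p then 1 else 0))))
  rw [hG]
  refine (congrArg (fun L : (Fin m → ℝ) →L[ℝ] ℝ => L (Pi.single t 1)) hd.fderiv).trans ?_
  simp only [smul_apply, add_apply,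
    ContinuousLinearMap.proj_apply, Pi.single_apply, smul_eq_mul, eq_comm (b := t)]
  ring

/-- Theorem 1.11(2): the Christoffel symbols `Γ` are symmetric and the curvature
tensor of the associated torsion-free connection satisfies
`Σ_l R_ijk^l(x) e_l = A_ε(e_i,e_j)e_k` at every point `x`, so the connection
realizes the affine projective Osserman model `𝔐_ε` at every point. -/
theorem stmt_9 (m : ℕ) (hm : 3 ≤ m) (ε : ℝ) :
    (∀ (i j k : Fin m) (x : Fin m → ℝ), Gam m hm ε i j k x = Gam m hm ε j i k x) ∧
    (∀ (x : Fin m → ℝ) (i j k : Fin m),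
      (fun l => curvGam m hm ε i j k l x)
        = Aeps m (by omega) ε (Pi.single i 1) (Pi.single j 1) (Pi.single k 1)) := by
  obtain ⟨a, ha⟩ : ∃ a : Fin m, (a : ℕ) = 0 := ⟨⟨0, by omega⟩, rfl⟩
  obtain ⟨b, hb⟩ : ∃ b : Fin m, (b : ℕ) = 1 := ⟨⟨1, by omega⟩, rfl⟩
  obtain ⟨p, hp⟩ : ∃ p : Fin m, (p : ℕ) = m - 1 := ⟨⟨m - 1, by omega⟩, rfl⟩
  have ha' : (⟨0, by omega⟩ : Fin m) = a := Fin.ext ha.symm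
  have hb' : (⟨1, by omega⟩ : Fin m) = b := Fin.ext hb.symm
  have hab : a ≠ b := by rw [Ne, Fin.ext_iff]; omega
  have hap : a ≠ p := by rw [Ne, Fin.ext_iff]; omega
  have hbp : b ≠ p := by rw [Ne, Fin.ext_iff]; omega
  constructor
  · intro i j k x
    simp only [Gam_eq_single hm ε ha hb hp, eq_comm (a := j) (b := i)]
    ring
  · intro x i j k
    funext l
    simp only [curvGam, Finset.sum_sub_distrib, sum_Gam_mul hm ε ha hb hp]
    simp only [fderiv_Gam_single hm ε ha hb hp, Gam_eq_single hm ε ha hb hp, Aeps, ha', hb',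
      Pi.sub_apply, Pi.add_apply, Pi.smul_apply, smul_eq_mul, Pi.single_apply,
      mul_ite, mul_one, mul_zero, Finset.sum_ite_eq', Finset.mem_univ, if_true]
    generalize x a + x b = s
    clear ha hb hp ha' hb'
    simp only [eq_comm (a := a) (b := i), eq_comm (a := a) (b := j), eq_comm (a := a) (b := k),
      eq_comm (a := b) (b := i), eq_comm (a := b) (b := j), eq_comm (a := b) (b := k),
      eq_comm (a := l) (b := i), eq_comm (a := l) (b := j),
      eq_comm (a := k) (b := i), eq_comm (a := k) (b := j)]
    rcases eq_or_ne i j with rfl | hij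
    · ring_nf
      grind
    by_cases hip : i = p
    · subst hip
      simp only [hij, hij.symm, hap, hbp, hap.symm, hbp.symm, if_true, if_false]
      grind (splits := 30)
    by_cases hjp : j = p
    · subst hjp
      simp only [hij, hij.symm, hap, hbp, hap.symm, hbp.symm, if_true, if_false]
      grind (splits := 30)
    simp only [hij, hij.symm, hip, hjp, if_false]
    grind (splits := 30)
end

section
/- Fix ε ∈ ℝ and m ≥ 2, and let A_ε(x,y)z := ⟨y,z⟩x − ⟨x,z⟩y − ε(x₁y₂ − x₂y₁)(z₁e₁ + z₂e₂) on ℝ^m. Then the Ricci tensor satisfies ρ(x,y) = (m−1)⟨x,y⟩ + ε(x₁y₂ − x₂y₁) for all x,y ∈ ℝ^m. In particular ρ_s(x,y) = (m−1)⟨x,y⟩ is positive definite, ρ(e₁,e₂) = ε, ρ(e₂,e₁) = −ε, and ρ is symmetric if and only if ε = 0. -/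
open Polynomial

/-- The Euclidean inner product with `x` as a linear functional. -/
noncomputable def dotL (m : ℕ) (x : Fin m → ℝ) : (Fin m → ℝ) →ₗ[ℝ] ℝ :=
  ∑ i, x i • LinearMap.proj i


/-- The endomorphism `z ↦ A_ε(z,x)y` of `ℝ^m`, as a linear map. -/
noncomputable def ricOp (m : ℕ) (hm : 2 ≤ m) (ε : ℝ) (x y : Fin m → ℝ) :
    (Fin m → ℝ) →ₗ[ℝ] (Fin m → ℝ) :=
  (∑ i, x i * y i) • LinearMap.id
  - (dotL m y).smulRight x
  - (ε • (x ⟨1, by omega⟩ • (LinearMap.proj (⟨0, by omega⟩ : Fin m) : (Fin m → ℝ) →ₗ[ℝ] ℝ)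
        - x ⟨0, by omega⟩ • (LinearMap.proj (⟨1, by omega⟩ : Fin m) : (Fin m → ℝ) →ₗ[ℝ] ℝ))).smulRight
      (y ⟨0, by omega⟩ • (Pi.single (⟨0, by omega⟩ : Fin m) (1 : ℝ) : Fin m → ℝ)
       + y ⟨1, by omega⟩ • (Pi.single (⟨1, by omega⟩ : Fin m) (1 : ℝ) : Fin m → ℝ))

/-- The Ricci tensor of `A_ε`: `ρ(x,y) = Tr(z ↦ A_ε(z,x)y)`. -/
noncomputable def ricAeps (m : ℕ) (hm : 2 ≤ m) (ε : ℝ) (x y : Fin m → ℝ) : ℝ :=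
  LinearMap.trace ℝ (Fin m → ℝ) (ricOp m hm ε x y)

/-- The symmetrized Ricci tensor of `A_ε`. -/
noncomputable def ricsAeps (m : ℕ) (hm : 2 ≤ m) (ε : ℝ) (x y : Fin m → ℝ) : ℝ :=
  (ricAeps m hm ε x y + ricAeps m hm ε y x) / 2

theorem dotL_apply (m : ℕ) (x z : Fin m → ℝ) : dotL m x z = ∑ i, x i * z i := by
  simp [dotL]

theorem ricOp_apply (m : ℕ) (hm : 2 ≤ m) (ε : ℝ) (x y z : Fin m → ℝ) :
    ricOp m hm ε x y z = Aeps m hm ε z x y := by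
  have h : dotL m y z = ∑ i, z i * y i := by
    rw [dotL_apply]
    exact Finset.sum_congr rfl fun i _ => mul_comm _ _
  ext i
  simp only [ricOp, Aeps, LinearMap.sub_apply, LinearMap.smul_apply, LinearMap.id_apply,
    LinearMap.smulRight_apply, LinearMap.proj_apply, h, Pi.sub_apply, Pi.smul_apply,
    Pi.add_apply, smul_eq_mul]
  ring

theorem ricAeps_eq (m : ℕ) (hm : 2 ≤ m) (ε : ℝ) (x y : Fin m → ℝ) :
    ricAeps m hm ε x y
      = ((m - 1 : ℕ) : ℝ) * (∑ i, x i * y i)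
        + ε * (x ⟨0, by omega⟩ * y ⟨1, by omega⟩ - x ⟨1, by omega⟩ * y ⟨0, by omega⟩) := by
  have h : dotL m y x = ∑ i, x i * y i := by
    rw [dotL_apply]
    exact Finset.sum_congr rfl fun i _ => mul_comm _ _
  rw [ricAeps, ricOp, map_sub, map_sub, map_smul, LinearMap.trace_smulRight,
    LinearMap.trace_smulRight, h, LinearMap.trace_id, Module.finrank_fin_fun, Nat.cast_sub (by omega)]
  simp
  ring

theorem ricsAeps_eq (m : ℕ) (hm : 2 ≤ m) (ε : ℝ) (x y : Fin m → ℝ) :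
    ricsAeps m hm ε x y = ((m - 1 : ℕ) : ℝ) * (∑ i, x i * y i) := by
  have h : ∑ i, y i * x i = ∑ i, x i * y i :=
    Finset.sum_congr rfl fun i _ => mul_comm _ _
  rw [ricsAeps, ricAeps_eq, ricAeps_eq, h]
  ring

theorem ricsAeps_self_pos (m : ℕ) (hm : 2 ≤ m) (ε : ℝ) (x : Fin m → ℝ) (hx : x ≠ 0) :
    0 < ricsAeps m hm ε x x := by
  rw [ricsAeps_eq]
  obtain ⟨i, hi⟩ := Function.ne_iff.mp hx
  refine mul_pos (Nat.cast_pos.mpr (by omega)) ?_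
  exact Finset.sum_pos' (fun j _ => mul_self_nonneg _)
    ⟨i, Finset.mem_univ i, mul_self_pos.mpr hi⟩

theorem ricAeps_single_zero_one (m : ℕ) (hm : 2 ≤ m) (ε : ℝ) :
    ricAeps m hm ε (Pi.single ⟨0, by omega⟩ 1) (Pi.single ⟨1, by omega⟩ 1) = ε := by
  rw [ricAeps_eq]
  simp [Pi.single_apply]

theorem ricAeps_single_one_zero (m : ℕ) (hm : 2 ≤ m) (ε : ℝ) :
    ricAeps m hm ε (Pi.single ⟨1, by omega⟩ 1) (Pi.single ⟨0, by omega⟩ 1) = -ε := by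
  rw [ricAeps_eq]
  simp [Pi.single_apply]

/-- The Ricci tensor of the model `𝔐_ε` is
`ρ(x,y) = (m−1)⟨x,y⟩ + ε(x₁y₂ − x₂y₁)`; in particular
`ρ_s(x,y) = (m−1)⟨x,y⟩` is positive definite, `ρ(e₁,e₂) = ε`, `ρ(e₂,e₁) = −ε`,
and `ρ` is symmetric if and only if `ε = 0`. -/
theorem stmt_10 (m : ℕ) (hm : 2 ≤ m) (ε : ℝ) :
    (∀ x y z : Fin m → ℝ, ricOp m hm ε x y z = Aeps m hm ε z x y) ∧
    (∀ x y : Fin m → ℝ,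
      ricAeps m hm ε x y
        = ((m - 1 : ℕ) : ℝ) * (∑ i, x i * y i)
          + ε * (x ⟨0, by omega⟩ * y ⟨1, by omega⟩ - x ⟨1, by omega⟩ * y ⟨0, by omega⟩)) ∧
    (∀ x y : Fin m → ℝ,
      ricsAeps m hm ε x y = ((m - 1 : ℕ) : ℝ) * (∑ i, x i * y i)) ∧
    (∀ x : Fin m → ℝ, x ≠ 0 → 0 < ricsAeps m hm ε x x) ∧
    ricAeps m hm ε (Pi.single ⟨0, by omega⟩ 1) (Pi.single ⟨1, by omega⟩ 1) = ε ∧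
    ricAeps m hm ε (Pi.single ⟨1, by omega⟩ 1) (Pi.single ⟨0, by omega⟩ 1) = -ε ∧
    ((∀ x y : Fin m → ℝ, ricAeps m hm ε x y = ricAeps m hm ε y x) ↔ ε = 0) := by
  refine ⟨ricOp_apply m hm ε, ricAeps_eq m hm ε, ricsAeps_eq m hm ε, ricsAeps_self_pos m hm ε,
    ricAeps_single_zero_one m hm ε, ricAeps_single_one_zero m hm ε, fun h => ?_, ?_⟩
  · have h01 := h (Pi.single ⟨0, by omega⟩ 1) (Pi.single ⟨1, by omega⟩ 1)
    rw [ricAeps_single_zero_one, ricAeps_single_one_zero] at h01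
    linarith
  · rintro rfl x y
    rw [ricAeps_eq, ricAeps_eq, zero_mul, zero_mul]
    simp only [mul_comm]
end

section
/- Let m ≥ 3 and define constant Christoffel symbols on ℝ^m by Γ_{mm}{}^m = 2, Γ_{im}{}^i = Γ_{mi}{}^i = Γ_{ii}{}^m = 1 for 1 ≤ i ≤ m−1, and all other components zero; let ∇_{∂_i}u := Σ_{j,k} Γ_{ij}{}^k u^j e_k for a constant vector u = Σ_j u^j e_j, and let R(∂_i,∂_j)∂_k := Σ_l R_{ijk}{}^l e_l with R_{ijk}{}^l := Σ_n(Γ_{in}{}^l Γ_{jk}{}^n − Γ_{jn}{}^l Γ_{ik}{}^n). Then the covariant derivative of the curvature satisfies ∇_{∂_m}(R(∂_m,∂_1)∂_1) − R(∇_{∂_m}∂_m, ∂_1)∂_1 − R(∂_m, ∇_{∂_m}∂_1)∂_1 − R(∂_m,∂_1)(∇_{∂_m}∂_1) = −2e_m ≠ 0. Consequently ∇R ≠ 0, so this affine manifold is not locally symmetric. -/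
/-- The constant Christoffel symbols realizing the model `𝔐₀`:
`Γ_mm^m = 2`, `Γ_im^i = Γ_mi^i = Γ_ii^m = 1` for `i < m`, all other components
zero (0-based indexing: the paper's index `m` is `m−1` here). -/
def Gc (m : ℕ) (i j k : Fin m) : ℝ :=
  (if i = j ∧ j = k ∧ (k : ℕ) = m - 1 then 2 else 0)
  + (if (i : ℕ) < m - 1 ∧ (j : ℕ) = m - 1 ∧ k = i then 1 else 0)
  + (if (j : ℕ) < m - 1 ∧ (i : ℕ) = m - 1 ∧ k = j then 1 else 0)
  + (if (i : ℕ) < m - 1 ∧ i = j ∧ (k : ℕ) = m - 1 then 1 else 0)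

/-- The covariant derivative `∇_{∂_i} u` of a constant vector field `u`:
`(∇_{∂_i} u)^k = Σ_j Γ_ij^k u^j`. -/
noncomputable def covC (m : ℕ) (i : Fin m) (u : Fin m → ℝ) : Fin m → ℝ :=
  fun k => ∑ j, Gc m i j k * u j

/-- The curvature of the constant-coefficient connection, evaluated on constant
vectors: `R(u,v)w = Σ_{i,j,k} u^i v^j w^k Σ_n (Γ_in^l Γ_jk^n − Γ_jn^l Γ_ik^n) e_l`. -/
noncomputable def RopC (m : ℕ) (u v w : Fin m → ℝ) : Fin m → ℝ :=
  fun l => ∑ i, ∑ j, ∑ k, u i * v j * w k *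
    (∑ n, (Gc m i n l * Gc m j k n - Gc m j n l * Gc m i k n))

theorem covC_single (m : ℕ) (i j : Fin m) :
    covC m i (Pi.single j 1) = fun k => Gc m i j k := by
  funext k
  simp [covC, Pi.single_apply]

theorem RopC_smul_left (m : ℕ) (a : ℝ) (u v w : Fin m → ℝ) :
    RopC m (a • u) v w = a • RopC m u v w := by
  funext l
  simp only [RopC, Pi.smul_apply, smul_eq_mul, Finset.mul_sum]
  refine Finset.sum_congr rfl fun i _ => Finset.sum_congr rfl fun j _ =>
    Finset.sum_congr rfl fun k _ => Finset.sum_congr rfl fun n _ => by ring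

/-- On coordinate vectors the curvature is the commutator of covariant derivatives. -/
theorem RopC_single (m : ℕ) (i j k : Fin m) :
    RopC m (Pi.single i 1) (Pi.single j 1) (Pi.single k 1) =
      covC m i (covC m j (Pi.single k 1)) - covC m j (covC m i (Pi.single k 1)) := by
  funext l
  simp [RopC, covC, Pi.single_apply, Finset.sum_sub_distrib]

theorem covC_last_last (m : ℕ) (i : Fin m) (hi : (i : ℕ) = m - 1) :
    covC m i (Pi.single i 1) = (2 : ℝ) • Pi.single i 1 := by
  rw [covC_single]
  funext k
  simp only [Gc, Pi.smul_apply, Pi.single_apply, smul_eq_mul, Fin.ext_iff, true_and]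
  split_ifs <;> first | omega | norm_num

theorem covC_last_of_lt (m : ℕ) (i j : Fin m) (hi : (i : ℕ) = m - 1) (hj : (j : ℕ) < m - 1) :
    covC m i (Pi.single j 1) = Pi.single j 1 := by
  rw [covC_single]
  funext k
  simp only [Gc, Pi.single_apply, Fin.ext_iff]
  split_ifs <;> first | omega | norm_num

theorem covC_self_of_lt (m : ℕ) (i j : Fin m) (hi : (i : ℕ) = m - 1) (hj : (j : ℕ) < m - 1) :
    covC m j (Pi.single j 1) = Pi.single i 1 := by
  rw [covC_single]
  funext k
  simp only [Gc, Pi.single_apply, Fin.ext_iff, true_and]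
  split_ifs <;> first | omega | norm_num

theorem RopC_last_self (m : ℕ) (i j : Fin m) (hi : (i : ℕ) = m - 1) (hj : (j : ℕ) < m - 1) :
    RopC m (Pi.single i 1) (Pi.single j 1) (Pi.single j 1) = Pi.single i 1 := by
  rw [RopC_single, covC_last_of_lt m i j hi hj, covC_self_of_lt m i j hi hj,
    covC_last_last m i hi, two_smul, add_sub_cancel_right]

/-- The affine manifold realizing `𝔐₀` is not locally symmetric:
`∇_{∂_m}(R(∂_m,∂_1)∂_1) − R(∇_{∂_m}∂_m,∂_1)∂_1 − R(∂_m,∇_{∂_m}∂_1)∂_1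
 − R(∂_m,∂_1)(∇_{∂_m}∂_1) = −2·e_m ≠ 0`, so `∇R ≠ 0`. -/
theorem stmt_16 (m : ℕ) (hm : 3 ≤ m) :
    (covC m ⟨m - 1, by omega⟩
        (RopC m (Pi.single ⟨m - 1, by omega⟩ 1) (Pi.single ⟨0, by omega⟩ 1)
          (Pi.single ⟨0, by omega⟩ 1))
      - RopC m (covC m ⟨m - 1, by omega⟩ (Pi.single ⟨m - 1, by omega⟩ 1))
          (Pi.single ⟨0, by omega⟩ 1) (Pi.single ⟨0, by omega⟩ 1)
      - RopC m (Pi.single ⟨m - 1, by omega⟩ 1)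
          (covC m ⟨m - 1, by omega⟩ (Pi.single ⟨0, by omega⟩ 1))
          (Pi.single ⟨0, by omega⟩ 1)
      - RopC m (Pi.single ⟨m - 1, by omega⟩ 1) (Pi.single ⟨0, by omega⟩ 1)
          (covC m ⟨m - 1, by omega⟩ (Pi.single ⟨0, by omega⟩ 1)))
      = (-2 : ℝ) • (Pi.single (⟨m - 1, by omega⟩ : Fin m) (1 : ℝ) : Fin m → ℝ) ∧
    (-2 : ℝ) • (Pi.single (⟨m - 1, by omega⟩ : Fin m) (1 : ℝ) : Fin m → ℝ) ≠ 0 := by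
  have hlt : 0 < m - 1 := by omega
  constructor
  · rw [covC_last_last m ⟨m - 1, by omega⟩ rfl,
      covC_last_of_lt m ⟨m - 1, by omega⟩ ⟨0, by omega⟩ rfl hlt, RopC_smul_left,
      RopC_last_self m ⟨m - 1, by omega⟩ ⟨0, by omega⟩ rfl hlt,
      covC_last_last m ⟨m - 1, by omega⟩ rfl]
    module
  · intro h
    simpa using congrFun h ⟨m - 1, by omega⟩
end

section
/- Let m ≥ 3 and define constant Christoffel symbols on ℝ^m by Γ_{mm}{}^m = 2, Γ_{im}{}^i = Γ_{mi}{}^i = Γ_{ii}{}^m = 1 for 1 ≤ i ≤ m−1, and all other components zero. Then the connection is geodesically incomplete: there is no C² curve γ : ℝ → ℝ^m defined on all of ℝ satisfying the geodesic equation γ''^k(t) + Σ_{i,j} Γ_{ij}{}^k γ'^i(t) γ'^j(t) = 0 for all t and all k, with initial conditions γ(0) = 0 and γ'(0) = −e_m. (Indeed, along curves of the form γ(t) = (0,…,0,x(t)) the geodesic equation reduces to x'' + 2(x')² = 0, whose solution with x(0) = 0, x'(0) = −1 blows up in finite time.) -/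
theorem Gc_last {m : ℕ} {k : Fin m} (hk : (k : ℕ) = m - 1) (i j : Fin m) :
    Gc m i j k = if i = j then (if i = k then 2 else 1) else 0 := by
  have hi := i.isLt
  have hj := j.isLt
  unfold Gc
  simp only [Fin.ext_iff, hk, and_true]
  split_ifs <;> first | omega | norm_num

theorem two_mul_sq_le_sum_Gc_last {m : ℕ} {k : Fin m} (hk : (k : ℕ) = m - 1) (v : Fin m → ℝ) :
    2 * v k ^ 2 ≤ ∑ i, ∑ j, Gc m i j k * v i * v j := by
  have h (i : Fin m) : ∑ j, Gc m i j k * v i * v j =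
      (if i = k then 2 else 1) * v i ^ 2 := by
    simp only [Gc_last hk, ite_mul, zero_mul, Finset.sum_ite_eq, Finset.mem_univ, if_true]
    split_ifs <;> ring
  simp only [h]
  refine le_trans (by simp) (Finset.single_le_sum (fun i _ => ?_) (Finset.mem_univ k))
  split_ifs <;> positivity

/-- The Riccati differential inequality `v' ≤ -2 v²` with `v 0 = -1` has no global solution. -/
theorem not_forall_deriv_le_neg_two_mul_sq {v : ℝ → ℝ} (hv : Differentiable ℝ v)
    (h0 : v 0 = -1) : ¬ ∀ t, deriv v t ≤ -(2 * v t ^ 2) := by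
  intro h
  have hanti : Antitone v := antitone_of_deriv_nonpos hv fun t =>
    (h t).trans (by nlinarith [sq_nonneg (v t)])
  have hneg (t : ℝ) (ht : 0 ≤ t) : v t < 0 := by linarith [hanti ht]
  have hder (t : ℝ) (ht : 0 ≤ t) :
      HasDerivAt (fun s => (v s)⁻¹ - 2 * s) (-deriv v t / v t ^ 2 - 2) t := by
    simpa using ((hv t).hasDerivAt.fun_inv (hneg t ht).ne).fun_sub
      ((hasDerivAt_id t).const_mul 2)
  have hmono : MonotoneOn (fun s => (v s)⁻¹ - 2 * s) (Set.Ici 0) := by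
    refine monotoneOn_of_deriv_nonneg (convex_Ici 0)
      (fun t ht => (hder t ht).continuousAt.continuousWithinAt) ?_ ?_
    all_goals
      intro t ht
      have ht' : 0 ≤ t := interior_subset ht
    · exact (hder t ht').differentiableAt.differentiableWithinAt
    · rw [(hder t ht').deriv, sub_nonneg, le_div_iff₀ (sq_pos_of_neg (hneg t ht'))]
      linarith [h t]
  have h1 := hmono (Set.mem_Ici.2 le_rfl) (Set.mem_Ici.2 zero_le_one) zero_le_one
  have h2 : (v 1)⁻¹ < 0 := inv_lt_zero.2 (hneg 1 zero_le_one)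
  norm_num [h0] at h1
  linarith

/-- Geodesic incompleteness of the connection realizing `𝔐₀`: there is no
globally defined C² geodesic `γ : ℝ → ℝ^m` with `γ(0) = 0` and `γ'(0) = −e_m`.
(Along the last axis the geodesic equation reduces to `x'' + 2(x')² = 0`, whose
solution with these initial conditions blows up in finite time.) -/
theorem stmt_17 (m : ℕ) (hm : 3 ≤ m) :
    ¬ ∃ γ : ℝ → (Fin m → ℝ),
        ContDiff ℝ 2 γ ∧
        (∀ (t : ℝ) (k : Fin m),
          deriv (deriv (fun s => γ s k)) t
            + ∑ i, ∑ j, Gc m i j k * deriv (fun s => γ s i) t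
                * deriv (fun s => γ s j) t = 0) ∧
        γ 0 = 0 ∧
        (fun k : Fin m => deriv (fun s => γ s k) 0)
          = -(Pi.single (⟨m - 1, by omega⟩ : Fin m) (1 : ℝ) : Fin m → ℝ) := by
  rintro ⟨γ, hγ, hgeo, -, hinit⟩
  have hdiff : Differentiable ℝ (deriv fun s => γ s ⟨m - 1, by omega⟩) :=
    ((contDiff_succ_iff_deriv (n := 1)).1
      (contDiff_pi.1 hγ ⟨m - 1, by omega⟩)).2.2.differentiable one_ne_zero
  refine not_forall_deriv_le_neg_two_mul_sq hdiff ?_ fun t => ?_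
  · simpa using congrFun hinit ⟨m - 1, by omega⟩
  · linarith [hgeo t ⟨m - 1, by omega⟩,
      two_mul_sq_le_sum_Gc_last (k := ⟨m - 1, by omega⟩) rfl fun i => deriv (fun s => γ s i) t]
end
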